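/- arXiv:2409.10731 — 2 statements merged into one kernel-verified Lean document; each statement's English description precedes it below -/
import Mathlib

section
/- Assume that for every prime ideal p of A, the largest invariant ideal p* = {x ∈ p : ψ(x) ∈ p ⊗ H} contained in p is again a prime ideal. Then the quasi-compact open subsets of Spec^inv(A) form a basis for its topology. -/
open TensorProduct

variable (k : Type*) [Field k]
variable (A : Type*) [CommRing A] [Algebra k A]
variable (H : Type*) [Ring H] [HopfAlgebra k H]

/-- The image `I ⊗ H` of the canonical map `I ⊗[k] H → A ⊗[k] H`, for an ideal `I` of `A`. -/
noncomputable def idealTensor (I : Ideal A) : Submodule k (A ⊗[k] H) :=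
  LinearMap.range (TensorProduct.map ((I.restrictScalars k).subtype)
    (LinearMap.id : H →ₗ[k] H))

/-- An ideal `I` of `A` is invariant (for the coaction `ψ : A → A ⊗[k] H`) if
`ψ x ∈ I ⊗ H` for all `x ∈ I`. -/
def IsInvariantIdeal (ψ : A →ₐ[k] A ⊗[k] H) (I : Ideal A) : Prop :=
  ∀ x ∈ I, ψ x ∈ idealTensor k A H I

/-- Coassociativity of the coaction `ψ`:
`(ψ ⊗ id_H) ∘ ψ = (id_A ⊗ Δ_H) ∘ ψ` as maps `A → A ⊗[k] H ⊗[k] H`. -/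
def IsCoassoc (ψ : A →ₐ[k] A ⊗[k] H) : Prop :=
  ∀ a : A,
    (TensorProduct.assoc k A H H)
        ((TensorProduct.map ψ.toLinearMap (LinearMap.id : H →ₗ[k] H)) (ψ a))
      = (TensorProduct.map (LinearMap.id : A →ₗ[k] A)
          (Coalgebra.comul (R := k) (A := H))) (ψ a)

/-- Counitality of the coaction `ψ`: `(id_A ⊗ ε_H) ∘ ψ = id_A` under the canonical
isomorphism `A ⊗[k] k ≅ A`. -/
def IsCounital (ψ : A →ₐ[k] A ⊗[k] H) : Prop :=
  ∀ a : A,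
    (TensorProduct.rid k A)
        ((TensorProduct.map (LinearMap.id : A →ₗ[k] A)
          (Coalgebra.counit (R := k) (A := H))) (ψ a)) = a

/-- The set `I* = {x ∈ I : ψ x ∈ I ⊗ H}`. -/
def starSet (ψ : A →ₐ[k] A ⊗[k] H) (I : Ideal A) : Set A :=
  {x : A | x ∈ I ∧ ψ x ∈ idealTensor k A H I}

/-- Slice of a tensor by a linear functional on `H`. -/
noncomputable def sliceMap (f : H →ₗ[k] k) : A ⊗[k] H →ₗ[k] A :=
  (TensorProduct.rid k A).toLinearMap ∘ₗ TensorProduct.map (LinearMap.id : A →ₗ[k] A) f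

theorem sliceMap_tmul (f : H →ₗ[k] k) (a : A) (h : H) :
    sliceMap k A H f (a ⊗ₜ h) = f h • a := by
  simp [sliceMap]

theorem slice_mem (I : Ideal A) (t : A ⊗[k] H) (ht : t ∈ idealTensor k A H I)
    (f : H →ₗ[k] k) : sliceMap k A H f t ∈ I := by
  obtain ⟨s, rfl⟩ := ht
  induction s with
  | zero => simp
  | add x y hx hy => rw [map_add, map_add]; exact I.add_mem hx hy
  | tmul x h =>
    rw [TensorProduct.map_tmul, sliceMap_tmul]
    exact (I.restrictScalars k).smul_mem _ x.2

theorem exists_slices (t : A ⊗[k] H) : ∃ (s : Finset (H →ₗ[k] k)) (v : (H →ₗ[k] k) → H),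
    t = ∑ f ∈ s, sliceMap k A H f t ⊗ₜ[k] v f := by
  classical
  let b := Module.Basis.ofVectorSpace k H
  have key : ∃ s : Finset (Module.Basis.ofVectorSpaceIndex k H), ∀ s', s ⊆ s' →
      t = ∑ i ∈ s', sliceMap k A H (b.coord i) t ⊗ₜ[k] b i := by
    induction t with
    | zero => exact ⟨∅, fun s' _ => by simp⟩
    | add x y hx hy =>
      obtain ⟨s1, h1⟩ := hx
      obtain ⟨s2, h2⟩ := hy
      refine ⟨s1 ∪ s2, fun s' hs => ?_⟩
      simp only [map_add, TensorProduct.add_tmul, Finset.sum_add_distrib]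
      rw [← h1 s' (Finset.union_subset_left hs), ← h2 s' (Finset.union_subset_right hs)]
    | tmul a h =>
      refine ⟨(b.repr h).support, fun s' hs => ?_⟩
      simp only [sliceMap_tmul, TensorProduct.smul_tmul, ← TensorProduct.tmul_sum]
      congr 1
      conv_lhs => rw [← b.linearCombination_repr h, Finsupp.linearCombination_apply]
      exact Finsupp.sum_of_support_subset _ hs _ (by simp)
  obtain ⟨s, hs⟩ := key
  have hinj : Function.Injective b.coord := by
    intro i j hij
    by_contra hne
    have := congrArg (fun f => f (b i)) hij
    simp [Finsupp.single_apply, hne] at this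
  have hne : Nonempty (Module.Basis.ofVectorSpaceIndex k H) ∨ s = ∅ := by
    rcases s.eq_empty_or_nonempty with h | ⟨i, _⟩
    · exact Or.inr h
    · exact Or.inl ⟨i⟩
  rcases hne with hne | hne
  · refine ⟨s.image b.coord, fun f => b (Function.invFun b.coord f), ?_⟩
    rw [Finset.sum_image (fun i _ j _ h => hinj h)]
    simp only [Function.leftInverse_invFun hinj _]
    exact hs s subset_rfl
  · refine ⟨∅, 0, ?_⟩
    have := hs s subset_rfl
    rw [hne] at this
    simpa using this

theorem mem_of_slice (I : Ideal A) (t : A ⊗[k] H)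
    (h : ∀ f : H →ₗ[k] k, sliceMap k A H f t ∈ I) : t ∈ idealTensor k A H I := by
  obtain ⟨s, v, hs⟩ := exists_slices k A H t
  rw [hs]
  refine Submodule.sum_mem _ fun f _ => ?_
  exact ⟨(⟨_, h f⟩ : I.restrictScalars k) ⊗ₜ v f, by simp⟩

theorem exists_finset_slices (t : A ⊗[k] H) : ∃ s : Finset (H →ₗ[k] k), ∀ I : Ideal A,
    t ∈ idealTensor k A H I ↔ ∀ f ∈ s, sliceMap k A H f t ∈ I := by
  obtain ⟨s, v, hs⟩ := exists_slices k A H t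
  refine ⟨s, fun I => ⟨fun h f _ => slice_mem k A H I t h f, fun h => ?_⟩⟩
  rw [hs]
  refine Submodule.sum_mem _ fun f hf => ?_
  exact ⟨(⟨_, h f hf⟩ : I.restrictScalars k) ⊗ₜ v f, by simp⟩

theorem counit_mem (ψ : A →ₐ[k] A ⊗[k] H) (hcu : IsCounital k A H ψ) (I : Ideal A) (x : A)
    (h : ψ x ∈ idealTensor k A H I) : x ∈ I := by
  have := slice_mem k A H I _ h (Coalgebra.counit (R := k) (A := H))
  rw [← hcu x]
  exact this

theorem slice_coaction (ψ : A →ₐ[k] A ⊗[k] H) (hco : IsCoassoc k A H ψ) (f g : H →ₗ[k] k)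
    (x : A) : sliceMap k A H g (ψ (sliceMap k A H f (ψ x))) =
      sliceMap k A H (LinearMap.mul' k k ∘ₗ TensorProduct.map g f ∘ₗ Coalgebra.comul) (ψ x) := by
  let T : A ⊗[k] (H ⊗[k] H) →ₗ[k] A := (TensorProduct.rid k A).toLinearMap ∘ₗ
    TensorProduct.map (LinearMap.id : A →ₗ[k] A) (LinearMap.mul' k k ∘ₗ TensorProduct.map g f)
  have h1 : ∀ t : A ⊗[k] H, sliceMap k A H g (ψ (sliceMap k A H f t)) =
      T ((TensorProduct.assoc k A H H)
        ((TensorProduct.map ψ.toLinearMap (LinearMap.id : H →ₗ[k] H)) t)) := by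
    intro t
    induction t with
    | zero => simp
    | add x y hx hy => simp only [map_add, hx, hy]
    | tmul a h =>
      rw [sliceMap_tmul, map_smul, map_smul, TensorProduct.map_tmul]
      generalize hu : ψ a = u
      have hu' : ψ.toLinearMap a = u := hu
      rw [hu']
      clear hu hu'
      induction u with
      | zero => simp
      | add x y hx hy => simp only [map_add, TensorProduct.add_tmul, smul_add, hx, hy]
      | tmul c d => simp [T, sliceMap_tmul, smul_smul, mul_comm]
  have h2 : ∀ t : A ⊗[k] H, T ((TensorProduct.map (LinearMap.id : A →ₗ[k] A)
          (Coalgebra.comul (R := k) (A := H))) t) =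
      sliceMap k A H (LinearMap.mul' k k ∘ₗ TensorProduct.map g f ∘ₗ Coalgebra.comul) t := by
    intro t
    induction t with
    | zero => simp
    | add x y hx hy => simp only [map_add, hx, hy]
    | tmul a h => simp [T, sliceMap_tmul]
  rw [h1, hco x, h2]

theorem star_invariant (ψ : A →ₐ[k] A ⊗[k] H) (hco : IsCoassoc k A H ψ) (p q : Ideal A)
    (hq : (q : Set A) = starSet k A H ψ p) : IsInvariantIdeal k A H ψ q := by
  intro x hx
  have hx' : x ∈ starSet k A H ψ p := hq ▸ hx
  refine mem_of_slice k A H q _ fun f => ?_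
  change _ ∈ (q : Set A)
  rw [hq]
  refine ⟨slice_mem k A H p _ hx'.2 f, mem_of_slice k A H p _ fun g => ?_⟩
  rw [slice_coaction k A H ψ hco]
  exact slice_mem k A H p _ hx'.2 _

/-- assuming `p*` is prime for every prime `p`, the quasi-compact open
subsets of `Spec^inv(A)` form a basis for its topology. -/
theorem stmt13 (ψ : A →ₐ[k] A ⊗[k] H)
    (hco : IsCoassoc k A H ψ) (hcu : IsCounital k A H ψ)
    (hstar : ∀ p : Ideal A, p.IsPrime →
      ∃ q : Ideal A, (q : Set A) = starSet k A H ψ p ∧ q.IsPrime) :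
    TopologicalSpace.IsTopologicalBasis
      {U : Set {q : PrimeSpectrum A // IsInvariantIdeal k A H ψ q.asIdeal} |
        IsOpen U ∧ IsCompact U} := by
  classical
  choose Q hQ hQp using hstar
  let S := {q : PrimeSpectrum A // IsInvariantIdeal k A H ψ q.asIdeal}
  let F : PrimeSpectrum A → S := fun p =>
    ⟨⟨Q p.asIdeal p.2, hQp _ _⟩, star_invariant k A H ψ hco p.asIdeal _ (hQ _ _)⟩
  have hF : ∀ (p : PrimeSpectrum A) (x : A),
      x ∈ (F p).1.asIdeal ↔ ψ x ∈ idealTensor k A H p.asIdeal := by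
    intro p x
    change x ∈ (Q p.asIdeal p.2 : Set A) ↔ _
    rw [hQ]
    exact ⟨fun h => h.2, fun h => ⟨counit_mem k A H ψ hcu _ _ h, h⟩⟩
  have hFs : ∀ p : S, F p.1 = p := by
    intro p
    apply Subtype.ext
    apply PrimeSpectrum.ext
    ext x
    rw [hF]
    exact ⟨fun h => counit_mem k A H ψ hcu _ _ h, fun h => p.2 x h⟩
  have hpre : ∀ x : A, ∃ s : Finset A, F ⁻¹' {p : S | x ∉ p.1.asIdeal} =
      ⋃ y ∈ s, (PrimeSpectrum.basicOpen y : Set (PrimeSpectrum A)) := by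
    intro x
    obtain ⟨s, hs⟩ := exists_finset_slices k A H (ψ x)
    refine ⟨s.image fun f => sliceMap k A H f (ψ x), ?_⟩
    ext p
    simp only [Set.mem_preimage, Set.mem_setOf_eq, hF, hs]
    simp
  have hopen : ∀ x : A, IsOpen {p : S | x ∉ p.1.asIdeal} := fun x =>
    (PrimeSpectrum.basicOpen x).isOpen.preimage continuous_subtype_val
  have hbasis : TopologicalSpace.IsTopologicalBasis
      (Set.range fun x : A => {p : S | x ∉ p.1.asIdeal}) := by
    have := PrimeSpectrum.isTopologicalBasis_basic_opens (R := A)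
    have h := this.isInducing (Topology.IsInducing.subtypeVal (t := {q : PrimeSpectrum A |
      IsInvariantIdeal k A H ψ q.asIdeal}))
    rw [← Set.range_comp] at h
    exact h
  have hcont : Continuous F := by
    rw [hbasis.continuous_iff]
    rintro _ ⟨x, rfl⟩
    obtain ⟨s, hs⟩ := hpre x
    rw [hs]
    exact isOpen_biUnion fun y _ => (PrimeSpectrum.basicOpen y).isOpen
  have hcomp : ∀ x : A, IsCompact {p : S | x ∉ p.1.asIdeal} := by
    intro x
    obtain ⟨s, hs⟩ := hpre x
    rw [← Set.image_preimage_eq {p : S | x ∉ p.1.asIdeal} (fun p => ⟨p.1, hFs p⟩), hs]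
    exact (s.isCompact_biUnion fun y _ => PrimeSpectrum.isCompact_basicOpen y).image hcont
  refine TopologicalSpace.isTopologicalBasis_of_isOpen_of_nhds (fun U hU => hU.1) ?_
  intro a U ha hU
  obtain ⟨_, ⟨x, rfl⟩, hx, hxU⟩ := hbasis.exists_subset_of_mem_open ha hU
  exact ⟨_, ⟨hopen x, hcomp x⟩, hx, hxU⟩
end

section
/- Assume that for every prime ideal p of A, the largest invariant ideal p* = {x ∈ p : ψ(x) ∈ p ⊗ H} contained in p is again a prime ideal. Then Spec^inv(A) is a spectral space: it is quasi-compact and T0, it has a basis of quasi-compact open subsets closed under finite intersections, and every nonempty irreducible closed subset has a unique generic point. -/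
open TensorProduct

variable (k : Type*) [Field k]
variable (A : Type*) [CommRing A] [Algebra k A]
variable (H : Type*) [Ring H] [HopfAlgebra k H]

/-- `t ∈ I ⊗ H` iff all coefficients of `t` in a basis of `H` lie in `I`. -/
theorem mem_idealTensor_iff {ι : Type*} [DecidableEq ι] (b : Module.Basis ι k H) (I : Ideal A)
    (t : A ⊗[k] H) :
    t ∈ idealTensor k A H I ↔ ∀ i, TensorProduct.equivFinsuppOfBasisRight b t i ∈ I := by
  constructor
  · rintro ⟨s, rfl⟩ i
    induction s with
    | zero => simp
    | add x y hx hy =>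
      rw [map_add, map_add, Finsupp.add_apply]
      exact I.add_mem hx hy
    | tmul x h =>
      rw [TensorProduct.map_tmul, TensorProduct.equivFinsuppOfBasisRight_apply_tmul_apply]
      exact (I.restrictScalars k).smul_mem _ x.2
  · intro h
    rw [← (TensorProduct.equivFinsuppOfBasisRight b).symm_apply_apply t,
      TensorProduct.equivFinsuppOfBasisRight_symm_apply]
    refine Submodule.sum_mem _ fun i _ => ?_
    exact ⟨(⟨_, h i⟩ : I.restrictScalars k) ⊗ₜ b i, by simp⟩

/-- `id ⊗ g` preserves `I ⊗ H`. -/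
theorem map_mem_idealTensor (I : Ideal A) (g : H →ₗ[k] H) (t : A ⊗[k] H)
    (ht : t ∈ idealTensor k A H I) :
    TensorProduct.map (LinearMap.id : A →ₗ[k] A) g t ∈ idealTensor k A H I := by
  obtain ⟨s, rfl⟩ := ht
  induction s with
  | zero => simp
  | add x y hx hy =>
    rw [map_add, map_add]
    exact Submodule.add_mem _ hx hy
  | tmul x h => exact ⟨x ⊗ₜ g h, by simp⟩

/-- Contracting the last factor commutes with the coaction. -/
theorem coaction_contract (ψ : A →ₐ[k] A ⊗[k] H) (f : H →ₗ[k] k) (t : A ⊗[k] H) :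
    ψ (TensorProduct.rid k A (f.lTensor A t)) =
      TensorProduct.map (LinearMap.id : A →ₗ[k] A)
        ((TensorProduct.rid k H).toLinearMap ∘ₗ f.lTensor H)
        (TensorProduct.assoc k A H H
          (TensorProduct.map ψ.toLinearMap (LinearMap.id : H →ₗ[k] H) t)) := by
  induction t with
  | zero => simp
  | add x y hx hy => simp only [map_add, hx, hy]
  | tmul a h =>
    simp only [LinearMap.lTensor_tmul, TensorProduct.rid_tmul, map_smul, TensorProduct.map_tmul,
      AlgHom.toLinearMap_apply, LinearMap.id_apply]
    generalize ψ a = u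
    induction u with
    | zero => simp
    | add x y hx hy => simp only [smul_add, TensorProduct.add_tmul, map_add, hx, hy]
    | tmul a' h' => simp

/-- assuming `p*` is prime for every prime `p`, `Spec^inv(A)` is a
spectral space: quasi-compact, T0, with a basis of quasi-compact opens closed under
finite intersections, and every nonempty irreducible closed subset has a unique
generic point. -/
theorem stmt16 (ψ : A →ₐ[k] A ⊗[k] H)
    (hco : IsCoassoc k A H ψ) (hcu : IsCounital k A H ψ)
    (hstar : ∀ p : Ideal A, p.IsPrime →
      ∃ q : Ideal A, (q : Set A) = starSet k A H ψ p ∧ q.IsPrime) :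
    CompactSpace {q : PrimeSpectrum A // IsInvariantIdeal k A H ψ q.asIdeal} ∧
    T0Space {q : PrimeSpectrum A // IsInvariantIdeal k A H ψ q.asIdeal} ∧
    TopologicalSpace.IsTopologicalBasis
      {U : Set {q : PrimeSpectrum A // IsInvariantIdeal k A H ψ q.asIdeal} |
        IsOpen U ∧ IsCompact U} ∧
    (∀ U V : Set {q : PrimeSpectrum A // IsInvariantIdeal k A H ψ q.asIdeal},
      IsOpen U → IsCompact U → IsOpen V → IsCompact V → IsCompact (U ∩ V)) ∧
    (∀ Z : Set {q : PrimeSpectrum A // IsInvariantIdeal k A H ψ q.asIdeal},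
      IsIrreducible Z → IsClosed Z →
        ∃! p : {q : PrimeSpectrum A // IsInvariantIdeal k A H ψ q.asIdeal},
          closure {p} = Z) := by
  classical
  let X := {q : PrimeSpectrum A // IsInvariantIdeal k A H ψ q.asIdeal}
  let b := Module.Basis.ofVectorSpace k H
  choose! st hst hstp using hstar
  let r : PrimeSpectrum A → X := fun p =>
    ⟨⟨st p.asIdeal, hstp _ p.isPrime⟩, star_invariant k A H ψ hco _ _ (hst _ p.isPrime)⟩
  have hmem : ∀ (p : PrimeSpectrum A) (x : A), x ∈ (r p).1.asIdeal ↔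
      x ∈ p.asIdeal ∧ ψ x ∈ idealTensor k A H p.asIdeal := fun p x => by
    change x ∈ (st p.asIdeal : Set A) ↔ _
    rw [hst _ p.isPrime]; rfl
  have hr : ∀ x : X, r x.1 = x := fun x => by
    apply Subtype.ext
    apply PrimeSpectrum.ext
    ext a
    rw [hmem]
    exact ⟨fun h => h.1, fun h => ⟨h, x.2 a h⟩⟩
  have hsurj : Function.Surjective r := fun x => ⟨x.1, hr x⟩
  let D : A → Set X := fun a => Subtype.val ⁻¹' (PrimeSpectrum.basicOpen a : Set (PrimeSpectrum A))
  have hbasis : TopologicalSpace.IsTopologicalBasis (Set.range D) := by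
    have := PrimeSpectrum.isTopologicalBasis_basic_opens (R := A).isInducing
      (Topology.IsInducing.subtypeVal
        (t := {q : PrimeSpectrum A | IsInvariantIdeal k A H ψ q.asIdeal}))
    rw [← Set.range_comp] at this
    exact this
  have hpre : ∀ a, r ⁻¹' (D a) = (PrimeSpectrum.basicOpen a : Set (PrimeSpectrum A)) ∪
      ⋃ i ∈ (TensorProduct.equivFinsuppOfBasisRight b (ψ a)).support,
        (PrimeSpectrum.basicOpen (TensorProduct.equivFinsuppOfBasisRight b (ψ a) i) :
          Set (PrimeSpectrum A)) := by
    intro a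
    ext p
    have h1 : p ∈ r ⁻¹' (D a) ↔ a ∉ (r p).1.asIdeal := Iff.rfl
    rw [h1, hmem, mem_idealTensor_iff k A H b, not_and_or, not_forall]
    simp only [Set.mem_union, Set.mem_iUnion, SetLike.mem_coe, PrimeSpectrum.mem_basicOpen,
      Finsupp.mem_support_iff, exists_prop]
    refine or_congr Iff.rfl (exists_congr fun i => ⟨fun h => ⟨fun h0 => h ?_, h⟩, fun h => h.2⟩)
    rw [h0]
    exact Ideal.zero_mem _
  have hcont : Continuous r := by
    rw [hbasis.continuous_iff]
    rintro _ ⟨a, rfl⟩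
    rw [hpre]
    exact (PrimeSpectrum.basicOpen a).isOpen.union
      (isOpen_biUnion fun i _ => (PrimeSpectrum.basicOpen _).isOpen)
  have hcomp : ∀ a, IsCompact (D a) := by
    intro a
    rw [← Set.image_preimage_eq (D a) hsurj, hpre]
    exact ((PrimeSpectrum.isCompact_basicOpen a).union
      (Finset.isCompact_biUnion _ fun i _ => PrimeSpectrum.isCompact_basicOpen _)).image hcont
  have hinter : ∀ a c, IsCompact (D a ∩ D c) := by
    intro a c
    have : D a ∩ D c = D (a * c) := by
      simp only [D]
      rw [PrimeSpectrum.basicOpen_mul]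
      rfl
    rw [this]
    exact hcomp _
  have hT0 : T0Space X := inferInstance
  refine ⟨?_, hT0, (PrespectralSpace.of_isTopologicalBasis' hbasis hcomp).isTopologicalBasis,
    (QuasiSeparatedSpace.of_isTopologicalBasis hbasis hinter).inter_isCompact, ?_⟩
  · exact hsurj.compactSpace hcont
  · intro Z hZ hZc
    have hirr : IsIrreducible (Subtype.val '' Z : Set (PrimeSpectrum A)) :=
      hZ.image _ continuous_subtype_val.continuousOn
    have hg := hirr.isGenericPoint_genericPoint_closure.image hcont
    have himg : r '' (Subtype.val '' Z) = Z := by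
      rw [Set.image_image]
      simp only [hr, Set.image_id']
    rw [closure_image_closure hcont, himg, hZc.closure_eq] at hg
    exact ⟨_, hg, fun y hy => IsGenericPoint.eq (S := Z) hy hg⟩
end
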